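/- Let 𝒜 be the family of Lebesgue-measurable subsets A of (0,∞) satisfying λ(A) ≤ √(inf A), and for measurable f : (0,∞) → [0,∞] define ρ_Y(f) = sup_{A ∈ 𝒜} ∫_A f(t) dt. Then ρ_Y is not essentially subrearrangement-invariant: there do not exist constants 0 < c ≤ C < ∞ and a map ρ' from nonnegative measurable functions on (0,∞) to [0,∞] such that (i) ρ' is subrearrangement-invariant, meaning that for every measurable F ⊆ (0,∞), every strictly increasing bijection m : (0,∞) → F with m and m⁻¹ measure-preserving, and every measurable f : (0,∞) → [0,∞] with ρ_Y(f) < ∞, one has ρ'(f ∘ m) = ρ'(f · 1_F), and (ii) c·ρ_Y(f) ≤ ρ'(f) ≤ C·ρ_Y(f) for every measurable f : (0,∞) → [0,∞] with ρ_Y(f) < ∞. -/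

import Mathlib

open MeasureTheory Set ENNReal

/-- An MO-isomorphism between subsets `E, F` of `ℝ`: a strictly increasing bijection from `E`
onto `F` such that both it and its inverse are measure-preserving for Lebesgue measure. -/
structure MOIso (E F : Set ℝ) (m : ℝ → ℝ) : Prop where
  bijOn : Set.BijOn m E F
  strictMonoOn : StrictMonoOn m E
  measPres : ∀ A : Set ℝ, A ⊆ F → NullMeasurableSet A volume →
    NullMeasurableSet (E ∩ m ⁻¹' A) volume ∧ volume (E ∩ m ⁻¹' A) = volume A
  invMeasPres : ∀ B : Set ℝ, B ⊆ E → NullMeasurableSet B volume →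
    NullMeasurableSet (m '' B) volume ∧ volume (m '' B) = volume B

/-- The function norm `ρ_Y f = sup { ∫_A f : A ⊆ (0,∞) Lebesgue-measurable, λ(A) ≤ √(inf A) }`. -/
noncomputable def rhoY (f : ℝ → ℝ≥0∞) : ℝ≥0∞ :=
  ⨆ (A : Set ℝ) (_ : A ⊆ Ioi 0) (_ : NullMeasurableSet A volume)
    (_ : volume A ≤ ENNReal.ofReal (Real.sqrt (sInf A))),
    ∫⁻ t in A, f t

theorem moIso_add_right {N : ℝ} : MOIso (Ioi 0) (Ioi N) (fun t => t + N) where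
  bijOn := by
    refine ⟨fun t ht => ?_, (add_left_injective N).injOn, fun y hy => ⟨y - N, ?_, ?_⟩⟩
    · simpa using ht
    · simpa using hy
    · simp
  strictMonoOn := (add_left_strictMono (a := N)).strictMonoOn _
  measPres A hA hAm := by
    have h : Ioi 0 ∩ (fun t => t + N) ⁻¹' A = (fun t => t + N) ⁻¹' A :=
      inter_eq_right.2 fun t ht => by simpa using hA ht
    rw [h]
    exact ⟨hAm.preimage (measurePreserving_add_right volume N).quasiMeasurePreserving,
      measure_preimage_add_right volume N A⟩
  invMeasPres B _ hBm := by
    rw [image_add_right]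
    exact ⟨hBm.preimage (measurePreserving_add_right volume (-N)).quasiMeasurePreserving,
      measure_preimage_add_right volume (-N) B⟩

theorem rhoY_le_lintegral (f : ℝ → ℝ≥0∞) : rhoY f ≤ ∫⁻ t, f t :=
  iSup_le fun A => iSup_le fun _ => iSup_le fun _ => iSup_le fun _ =>
    setLIntegral_le_lintegral A f

theorem rhoY_indicator_Ioo_lt_top (a b : ℝ) : rhoY ((Ioo a b).indicator 1) < ∞ := by
  refine (rhoY_le_lintegral _).trans_lt ?_
  rw [lintegral_indicator_one measurableSet_Ioo, Real.volume_Ioo]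
  exact ofReal_lt_top

theorem rhoY_indicator_Ioo_zero_le (L : ℝ) :
    rhoY ((Ioo 0 L).indicator 1) ≤ ENNReal.ofReal (Real.sqrt L) := by
  refine iSup_le fun A => iSup_le fun hA => iSup_le fun _ => iSup_le fun hvol => ?_
  rw [lintegral_indicator_one measurableSet_Ioo, Measure.restrict_apply measurableSet_Ioo]
  rcases le_total L (sInf A) with h | h
  · have hbdd : BddBelow A := ⟨0, fun x hx => (hA hx).le⟩
    have hempty : Ioo 0 L ∩ A = ∅ := by
      ext x
      simp only [mem_inter_iff, mem_empty_iff_false, iff_false, not_and]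
      exact fun hx hxA => (hx.2.trans_le (h.trans (csInf_le hbdd hxA))).false
    simp [hempty]
  · exact (measure_mono inter_subset_right).trans
      (hvol.trans (ofReal_le_ofReal (Real.sqrt_le_sqrt h)))

theorem le_rhoY_indicator_Ioo {N L : ℝ} (hN : 0 ≤ N) (hL : 0 < L) (hLN : L ≤ Real.sqrt N) :
    ENNReal.ofReal L ≤ rhoY ((Ioo N (N + L)).indicator 1) := by
  have hvol : volume (Ioo N (N + L)) = ENNReal.ofReal L := by simp
  have hsub : Ioo N (N + L) ⊆ Ioi 0 := fun x hx => hN.trans_lt hx.1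
  have hadm : volume (Ioo N (N + L)) ≤
      ENNReal.ofReal (Real.sqrt (sInf (Ioo N (N + L)))) := by
    rw [hvol, csInf_Ioo (by linarith)]
    exact ofReal_le_ofReal hLN
  refine le_trans (le_of_eq ?_) (le_iSup_of_le (Ioo N (N + L)) <| le_iSup_of_le hsub <|
    le_iSup_of_le measurableSet_Ioo.nullMeasurableSet <| le_iSup_of_le hadm le_rfl)
  rw [lintegral_indicator_one measurableSet_Ioo, Measure.restrict_apply measurableSet_Ioo,
    inter_self, hvol]

/-- The function norm `ρ_Y` is not essentially subrearrangement-invariant: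
no equivalent functional `ρ'` is subrearrangement-invariant. -/
theorem stmt2 :
    ¬ ∃ (c C : ℝ) (ρ' : (ℝ → ℝ≥0∞) → ℝ≥0∞), 0 < c ∧ c ≤ C ∧
      -- (i) ρ' is subrearrangement-invariant
      (∀ F : Set ℝ, F ⊆ Ioi 0 → NullMeasurableSet F volume →
        ∀ m : ℝ → ℝ, MOIso (Ioi 0) F m →
          ∀ f : ℝ → ℝ≥0∞, Measurable f → rhoY f < ∞ →
            ρ' (f ∘ m) = ρ' (F.indicator f)) ∧
      -- (ii) ρ' is equivalent to ρ_Y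
      (∀ f : ℝ → ℝ≥0∞, Measurable f → rhoY f < ∞ →
        ENNReal.ofReal c * rhoY f ≤ ρ' f ∧ ρ' f ≤ ENNReal.ofReal C * rhoY f) := by
  rintro ⟨c, C, ρ', hc, hcC, hinv, hequiv⟩
  set k : ℝ := C / c + 1 with hk
  have hC : 0 < C := hc.trans_le hcC
  have hk0 : 0 < k := by positivity
  have hcomp : (Ioo (k ^ 4) (k ^ 4 + k ^ 2)).indicator (1 : ℝ → ℝ≥0∞) ∘ (fun t => t + k ^ 4) =
      (Ioo 0 (k ^ 2)).indicator 1 := by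
    ext t
    simp only [Function.comp_apply, indicator, mem_Ioo, Pi.one_apply]
    congr 1
    rw [lt_add_iff_pos_left, add_comm t, add_lt_add_iff_left]
  have hres : (Ioi (k ^ 4)).indicator
      ((Ioo (k ^ 4) (k ^ 4 + k ^ 2)).indicator (1 : ℝ → ℝ≥0∞)) =
      (Ioo (k ^ 4) (k ^ 4 + k ^ 2)).indicator 1 := by
    rw [indicator_indicator, inter_eq_right.2 Ioo_subset_Ioi_self]
  have hmeas (a b : ℝ) : Measurable ((Ioo a b).indicator (1 : ℝ → ℝ≥0∞)) :=
    measurable_one.indicator measurableSet_Ioo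
  have hshift := hinv (Ioi (k ^ 4)) (Ioi_subset_Ioi (by positivity))
    measurableSet_Ioi.nullMeasurableSet _ moIso_add_right _ (hmeas _ _)
    (rhoY_indicator_Ioo_lt_top (k ^ 4) (k ^ 4 + k ^ 2))
  rw [hcomp, hres] at hshift
  have hlower := (hequiv _ (hmeas _ _)
    (rhoY_indicator_Ioo_lt_top (k ^ 4) (k ^ 4 + k ^ 2))).1
  have hupper := (hequiv _ (hmeas _ _) (rhoY_indicator_Ioo_lt_top 0 (k ^ 2))).2
  have hsqrt : Real.sqrt (k ^ 4) = k ^ 2 := by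
    rw [show k ^ 4 = (k ^ 2) ^ 2 by ring, Real.sqrt_sq (by positivity)]
  have hbound : ENNReal.ofReal c * ENNReal.ofReal (k ^ 2) ≤
      ENNReal.ofReal C * ENNReal.ofReal k :=
    calc ENNReal.ofReal c * ENNReal.ofReal (k ^ 2)
        ≤ ENNReal.ofReal c * rhoY ((Ioo (k ^ 4) (k ^ 4 + k ^ 2)).indicator 1) := by
          gcongr
          exact le_rhoY_indicator_Ioo (by positivity) (by positivity) hsqrt.ge
      _ ≤ ENNReal.ofReal C * rhoY ((Ioo 0 (k ^ 2)).indicator 1) :=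
          hlower.trans (hshift ▸ hupper)
      _ ≤ ENNReal.ofReal C * ENNReal.ofReal k := by
          gcongr
          exact (rhoY_indicator_Ioo_zero_le _).trans_eq (by rw [Real.sqrt_sq hk0.le])
  rw [← ofReal_mul hc.le, ← ofReal_mul hC.le, ofReal_le_ofReal_iff (by positivity)] at hbound
  have hck : c * k = C + c := by rw [hk]; field_simp
  nlinarith [mul_pos hc hk0]
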